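/- Assume P{ξ > x} ~ e^{−x^β} as x → ∞ with some β ∈ (1/2, 1), and let σ² := E(W − 1)². Then P{W > x} ≥ exp{−(mx)^β + (β²σ²/2)·(mx)^{2β−1}·(1 + o(1))} as x → ∞; in particular, P{W > x}/F̄(mx) → ∞. -/

import Mathlib

open MeasureTheory Filter ProbabilityTheory


set_option maxHeartbeats 2000000 in
lemma gw_key_y (β σ2 : ℝ) (hβ : 1 / 2 < β) (hβ1 : β < 1) (hσ : 0 < σ2)
    (T Fbar : ℝ → ℝ) (q : ℝ → ℕ → ℝ)
    (hF : ∀ᶠ z : ℝ in atTop, Real.exp (-(z ^ β)) / 2 ≤ Fbar z)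
    (hT : ∀ (y A : ℝ) (p n : ℕ), 1 ≤ p → y ≤ p * n + p * (A * √n) →
      Fbar (p * n) * (q A n) ^ p ≤ T y)
    (hq : ∀ δ > 0, ∃ A > 0, ∀ᶠ n : ℕ in atTop, Real.exp (-(A ^ 2 * (1 + δ) / (2 * σ2))) ≤ q A n)
    (ε : ℝ) (hε : 0 < ε) :
    ∀ᶠ y : ℝ in atTop,
      Real.exp (-(y ^ β) + β ^ 2 * σ2 / 2 * y ^ (2 * β - 1) * (1 - ε)) ≤ T y := by
  obtain ⟨A, hA, hqA⟩ := hq (ε / 2) (by positivity)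
  obtain ⟨N, hN⟩ := eventually_atTop.1 hqA
  obtain ⟨X0, hX0⟩ := eventually_atTop.1 hF
  have hβ0 : 0 < β := by linarith
  set c := β * σ2 with hc
  have hc0 : 0 < c := by positivity
  set κ := (c / A) ^ 2 with hκ
  have hκ0 : 0 < κ := by positivity
  set L := A ^ 2 * (1 + ε / 2) / (2 * σ2) with hL
  have hL0 : 0 < L := by positivity
  have e1 : Tendsto (fun y : ℝ => y ^ (2 * β - 1)) atTop atTop := tendsto_rpow_atTop (by linarith)
  have e2 : Tendsto (fun y : ℝ => y ^ (2 - 2 * β)) atTop atTop := tendsto_rpow_atTop (by linarith)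
  have e3 : Tendsto (fun y : ℝ => y ^ (β - 1)) atTop (nhds 0) := by
    have := tendsto_rpow_neg_atTop (y := 1 - β) (by linarith)
    simpa using this
  have hη : 0 < β ^ 2 * σ2 * ε / 8 := by positivity
  have h3 : ∀ᶠ y : ℝ in atTop, y ^ (β - 1) < (β ^ 2 * σ2 * ε / 8) / (β * (κ + 1) * (A ^ 2 + 1)) :=
    e3.eventually (gt_mem_nhds (by positivity))
  filter_upwards [eventually_ge_atTop 1, eventually_ge_atTop (2 * X0),
    e1.eventually_ge_atTop ((Real.log 2 + L) / (β ^ 2 * σ2 * ε / 8)),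
    e2.eventually_ge_atTop (2 * N * (κ + 1)), h3] with y hy1 hyX hY1 hY2 hY3
  have hy0 : 0 < y := by linarith
  set Y := y ^ (2 * β - 1) with hYdef
  have hYge : 1 ≤ Y := Real.one_le_rpow hy1 (by linarith)
  set p : ℕ := ⌈κ * Y⌉₊ with hp
  have hp1 : κ * Y ≤ p := Nat.le_ceil _
  have hp2 : (p : ℝ) ≤ κ * Y + 1 := (Nat.ceil_lt_add_one (by positivity)).le
  have hppos : 0 < (p : ℝ) := lt_of_lt_of_le (by positivity) hp1
  have hpone : 1 ≤ p := by exact_mod_cast hppos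
  set s := y / p with hs
  have hs0 : 0 < s := by positivity
  have hps : p * s = y := by rw [hs]; field_simp
  set R := s - A * √s + A ^ 2 with hR
  have hss : √s ^ 2 = s := Real.sq_sqrt hs0.le
  have hRs : s / 2 ≤ R := by nlinarith [sq_nonneg (√s - A), sq_nonneg A]
  set n : ℕ := ⌈R⌉₊ with hn
  have hn1 : R ≤ n := Nat.le_ceil _
  have hn2 : (n : ℝ) ≤ R + 1 := (Nat.ceil_lt_add_one (by linarith)).le
  have hsqn : √s - A ≤ √n := by
    apply Real.le_sqrt_of_sq_le
    nlinarith [mul_nonneg hA.le (Real.sqrt_nonneg s)]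
  have hyle : y ≤ p * n + p * (A * √n) := by
    have : s ≤ n + A * √n := by nlinarith
    calc y = p * s := hps.symm
      _ ≤ p * (n + A * √n) := by gcongr
      _ = _ := by ring
  have hpn : y / 2 ≤ p * n := by
    calc y / 2 = p * (s / 2) := by rw [← hps]; ring
      _ ≤ p * n := by gcongr; linarith
  -- n ≥ N
  have hYmul : y ^ (2 - 2 * β) * Y = y := by
    rw [hYdef, ← Real.rpow_add hy0]; ring_nf; simp
  have hsN : 2 * (N : ℝ) ≤ s := by
    rw [hs, le_div_iff₀ hppos]
    calc 2 * (N : ℝ) * p ≤ 2 * N * (κ * Y + 1) := by gcongr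
      _ ≤ 2 * N * (κ * Y + Y) := by gcongr
      _ = 2 * N * (κ + 1) * Y := by ring
      _ ≤ y ^ (2 - 2 * β) * Y := by gcongr
      _ = y := hYmul
  have hnN : N ≤ n := by
    have : (N : ℝ) ≤ n := by linarith
    exact_mod_cast this
  have hqn := hN n hnN
  have hFn := hX0 (p * n) (by linarith)
  refine le_trans ?_ (hT y A p n hpone hyle)
  have hlow : Real.exp (-(((p : ℝ) * n) ^ β)) / 2 * (Real.exp (-L)) ^ p ≤ Fbar (p * n) * q A n ^ p := by
    gcongr
    exact le_trans (by positivity) hFn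
  refine le_trans ?_ hlow
  have h2 : (2 : ℝ)⁻¹ = Real.exp (-Real.log 2) := by
    rw [Real.exp_neg, Real.exp_log (by norm_num)]
  rw [div_eq_mul_inv (Real.exp (-(((p : ℝ) * n) ^ β))), h2, ← Real.exp_nat_mul, ← Real.exp_add, ← Real.exp_add]
  apply Real.exp_le_exp.2
  -- concavity
  have hyβ : y ^ β * y ^ β = Y * y := by
    rw [hYdef, ← Real.rpow_add hy0]
    nth_rw 3 [← Real.rpow_one y]
    rw [← Real.rpow_add hy0]; ring_nf
  have hyβ1 : y ^ (β - 1) * y = y ^ β := by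
    rw [Real.rpow_sub_one hy0.ne']; field_simp
  have hyβ2 : y ^ (β - 1) * y ^ β = Y := by
    rw [hYdef, ← Real.rpow_add hy0]; ring_nf
  have hps2 : c * y ^ β ≤ p * (A * √s) := by
    apply le_of_sq_le_sq _ (by positivity)
    calc (c * y ^ β) ^ 2 = c ^ 2 * (y ^ β * y ^ β) := by ring
      _ = A ^ 2 * (κ * Y) * y := by rw [hyβ, hκ]; field_simp
      _ ≤ A ^ 2 * p * y := by gcongr
      _ = (p * (A * √s)) ^ 2 := by
        rw [mul_pow, mul_pow, hss, ← hps]; ring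
  have hpn2 : (p : ℝ) * n ≤ y - c * y ^ β + p * (A ^ 2 + 1) := by
    calc (p : ℝ) * n ≤ p * (R + 1) := by gcongr
      _ = p * s - p * (A * √s) + p * (A ^ 2 + 1) := by rw [hR]; ring
      _ ≤ _ := by rw [hps]; linarith
  have hconc : ((p : ℝ) * n) ^ β ≤ y ^ β + β * y ^ (β - 1) * (p * n - y) := by
    have hb := rpow_one_add_le_one_add_mul_self (s := (p * n - y) / y) (p := β)
      (by rw [le_div_iff₀ hy0]; nlinarith [mul_nonneg hppos.le (Nat.cast_nonneg (α := ℝ) n)]) hβ0.le hβ1.le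
    have h1 : 1 + ((p : ℝ) * n - y) / y = p * n / y := by field_simp; ring
    rw [h1, Real.div_rpow (by positivity) hy0.le, div_le_iff₀ (by positivity)] at hb
    refine hb.trans_eq ?_
    rw [← hyβ1]; field_simp
  have hz : 0 < y ^ (β - 1) := by positivity
  have hconc2 : ((p : ℝ) * n) ^ β ≤ y ^ β - β * c * Y + β * y ^ (β - 1) * (p * (A ^ 2 + 1)) := by
    refine hconc.trans ?_
    have : β * y ^ (β - 1) * (p * n - y) ≤ β * y ^ (β - 1) * (- (c * y ^ β) + p * (A ^ 2 + 1)) := by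
      gcongr; linarith
    have h5 : β * y ^ (β - 1) * (- (c * y ^ β) + p * (A ^ 2 + 1)) =
      - (β * c * (y ^ (β - 1) * y ^ β)) + β * y ^ (β - 1) * (p * (A ^ 2 + 1)) := by ring
    rw [hyβ2] at h5
    linarith
  have herr : β * y ^ (β - 1) * (p * (A ^ 2 + 1)) ≤ β ^ 2 * σ2 * ε / 8 * Y := by
    rw [lt_div_iff₀ (by positivity)] at hY3
    calc β * y ^ (β - 1) * (p * (A ^ 2 + 1)) ≤ β * y ^ (β - 1) * ((κ * Y + Y) * (A ^ 2 + 1)) := by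
          gcongr; linarith
      _ = y ^ (β - 1) * (β * (κ + 1) * (A ^ 2 + 1)) * Y := by ring
      _ ≤ _ := by gcongr
  have hpL : p * L ≤ β ^ 2 * σ2 / 2 * (1 + ε / 2) * Y + L := by
    calc p * L ≤ (κ * Y + 1) * L := by gcongr
      _ = _ := by rw [hκ, hL, hc]; field_simp
  rw [div_le_iff₀ hη] at hY1
  have hcY : β * c * Y = β ^ 2 * σ2 * Y := by rw [hc]; ring
  have hpL' : (p : ℝ) * -L = - (p * L) := by ring
  rw [hpL']
  nlinarith

lemma gw_final (β σ2 m : ℝ) (hβ : 1 / 2 < β) (hm : 0 < m) (hσ : 0 < σ2)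
    (T Fbar : ℝ → ℝ)
    (htail : Tendsto (fun x : ℝ => Fbar x / Real.exp (-(x ^ β))) atTop (nhds 1))
    (h : ∀ ε > 0, ∀ᶠ y : ℝ in atTop,
      Real.exp (-((m * y) ^ β) + β ^ 2 * σ2 / 2 * (m * y) ^ (2 * β - 1) * (1 - ε)) ≤ T y) :
    (∃ e : ℝ → ℝ, Tendsto e atTop (nhds 0) ∧
      ∀ᶠ x : ℝ in atTop,
        Real.exp (-((m * x) ^ β) +
            β ^ 2 * σ2 / 2 * (m * x) ^ (2 * β - 1) * (1 + e x)) ≤ T x) ∧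
    Tendsto (fun x : ℝ => T x / Fbar (m * x)) atTop atTop := by
  have hmx : Tendsto (fun x : ℝ => m * x) atTop atTop := tendsto_id.const_mul_atTop hm
  have hβ0 : 0 < β := by linarith
  constructor
  · refine ⟨fun x => min 0 ((Real.log (T x) + (m * x) ^ β) / (β ^ 2 * σ2 / 2 * (m * x) ^ (2 * β - 1)) - 1), ?_, ?_⟩
    · rw [Metric.tendsto_nhds]
      intro ε hε
      filter_upwards [h (ε / 2) (by positivity), eventually_gt_atTop 0] with x hx hx0
      have hD : 0 < β ^ 2 * σ2 / 2 * (m * x) ^ (2 * β - 1) := by positivity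
      have hl := Real.log_le_log (Real.exp_pos _) hx
      rw [Real.log_exp] at hl
      have : 1 - ε / 2 ≤ (Real.log (T x) + (m * x) ^ β) / (β ^ 2 * σ2 / 2 * (m * x) ^ (2 * β - 1)) := by
        rw [le_div_iff₀ hD]; linarith
      rw [Real.dist_eq, sub_zero, abs_of_nonpos (min_le_left _ _), neg_lt]
      apply lt_min <;> linarith
    · filter_upwards [h 1 one_pos, eventually_gt_atTop 0] with x hx hx0
      have hD : 0 < β ^ 2 * σ2 / 2 * (m * x) ^ (2 * β - 1) := by positivity
      have hTp : 0 < T x := lt_of_lt_of_le (Real.exp_pos _) hx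
      conv_rhs => rw [← Real.exp_log hTp]
      apply Real.exp_le_exp.2
      set D := β ^ 2 * σ2 / 2 * (m * x) ^ (2 * β - 1)
      have := mul_le_mul_of_nonneg_left (min_le_right 0 ((Real.log (T x) + (m * x) ^ β) / D - 1)) hD.le
      have h3 : D * ((Real.log (T x) + (m * x) ^ β) / D - 1) = Real.log (T x) + (m * x) ^ β - D := by
        field_simp
      linarith
  · have hF : ∀ᶠ x : ℝ in atTop, Fbar (m * x) / Real.exp (-((m * x) ^ β)) ∈ Set.Ioo (1/2 : ℝ) 2 :=
      (htail.comp hmx).eventually (Ioo_mem_nhds (by norm_num) (by norm_num))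
    have hlim : Tendsto (fun x : ℝ => Real.exp (β ^ 2 * σ2 / 2 * (m * x) ^ (2 * β - 1) * (1 - 1/2)) / 2) atTop atTop := by
      apply Tendsto.atTop_div_const (by norm_num)
      apply Real.tendsto_exp_atTop.comp
      apply Tendsto.atTop_mul_const (by norm_num)
      apply Tendsto.const_mul_atTop (by positivity)
      exact (tendsto_rpow_atTop (by linarith)).comp hmx
    refine tendsto_atTop_mono' _ ?_ hlim
    filter_upwards [h (1/2) (by norm_num), hF] with x hx hx2
    have hE := Real.exp_pos (-((m * x) ^ β))
    have h1 := (lt_div_iff₀ hE).1 hx2.1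
    have h2 := (div_lt_iff₀ hE).1 hx2.2
    rw [Real.exp_add] at hx
    rw [le_div_iff₀ (by linarith)]
    refine le_trans ?_ hx
    have := Real.exp_pos (β ^ 2 * σ2 / 2 * (m * x) ^ (2 * β - 1) * (1 - 1/2))
    nlinarith


lemma gw_gauss_lower (σ2 : ℝ) (hσ : 0 < σ2) (δ : ℝ) (hδ : 0 < δ) :
    ∃ A > 0, ENNReal.ofReal (Real.exp (-(A ^ 2 * (1 + δ) / (2 * σ2)))) <
      gaussianReal 0 σ2.toNNReal (Set.Ioi A) := by
  set C := (√(2 * Real.pi * σ2))⁻¹ with hC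
  have hC0 : 0 < C := by positivity
  set K := |1 - 2 * σ2 * Real.log C| + 1 with hK
  have hK0 : 0 < K := by positivity
  set A := max 1 ((2 + K) / δ) with hA
  have hA1 : 1 ≤ A := le_max_left _ _
  have hA2 : 2 + K ≤ δ * A := by
    have : (2 + K) / δ ≤ A := le_max_right _ _
    rw [div_le_iff₀ hδ] at this; linarith
  have hv : σ2.toNNReal ≠ 0 := by simpa using hσ
  refine ⟨A, by linarith, ?_⟩
  have hlt : Real.exp (-(A ^ 2 * (1 + δ) / (2 * σ2))) < C * Real.exp (-(A + 1) ^ 2 / (2 * σ2)) := by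
    conv_rhs => rw [← Real.exp_log hC0, ← Real.exp_add]
    apply Real.exp_lt_exp.2
    have h1 : K ≤ A * (δ * A - 2) := by nlinarith
    have h2 : 1 - 2 * σ2 * Real.log C < K := by
      have := le_abs_self (1 - 2 * σ2 * Real.log C); linarith
    have h3 : Real.log C = (2 * σ2 * Real.log C) / (2 * σ2) := by field_simp
    rw [h3, ← neg_div, ← add_div]
    apply div_lt_div_of_pos_right _ (by positivity)
    nlinarith
  calc ENNReal.ofReal (Real.exp (-(A ^ 2 * (1 + δ) / (2 * σ2))))
      < ENNReal.ofReal (C * Real.exp (-(A + 1) ^ 2 / (2 * σ2))) :=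
        (ENNReal.ofReal_lt_ofReal_iff (by positivity)).2 hlt
    _ = ∫⁻ x in Set.Ioc A (A + 1), ENNReal.ofReal (C * Real.exp (-(A + 1) ^ 2 / (2 * σ2))) := by
        simp
    _ ≤ ∫⁻ x in Set.Ioc A (A + 1), gaussianPDF 0 σ2.toNNReal x := by
        apply setLIntegral_mono' measurableSet_Ioc
        intro x hx
        rw [gaussianPDF_def, gaussianPDFReal_def]
        apply ENNReal.ofReal_le_ofReal
        simp only [Real.coe_toNNReal _ hσ.le, sub_zero]
        rw [← hC]
        have := hx.1; have := hx.2
        have : 0 ≤ x := by linarith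
        gcongr
    _ = gaussianReal 0 σ2.toNNReal (Set.Ioc A (A + 1)) := (gaussianReal_apply _ hv _).symm
    _ ≤ _ := measure_mono Set.Ioc_subset_Ioi_self

/-- law of the sum of k iid copies -/
noncomputable def gwS (ν : Measure ℝ) (k : ℕ) : Measure ℝ :=
  (Measure.infinitePi (fun _ : ℕ => ν)).map (fun w => ∑ i ∈ Finset.range k, w i)

instance gwS_prob (ν : Measure ℝ) [IsProbabilityMeasure ν] (k : ℕ) : IsProbabilityMeasure (gwS ν k) :=
  Measure.isProbabilityMeasure_map (by fun_prop)

lemma gw_indep_pi (ν : Measure ℝ) [IsProbabilityMeasure ν] :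
    iIndepFun (fun (i : ℕ) (w : ℕ → ℝ) => w i) (Measure.infinitePi (fun _ : ℕ => ν)) :=
  iIndepFun_infinitePi (P := fun _ : ℕ => ν) (X := fun _ x => x) (fun _ => measurable_id)

lemma gwS_charFun (ν : Measure ℝ) [IsProbabilityMeasure ν] (k : ℕ) (t : ℝ) :
    charFun (gwS ν k) t = charFun ν t ^ k := by
  rw [gwS, ((gw_indep_pi ν).restrict _).charFun_map_fun_finsetSum_eq_prod (fun i _ => (measurable_pi_apply i).aemeasurable)]
  simp [Measure.infinitePi_map_eval]

lemma gwS_conv (ν : Measure ℝ) [IsProbabilityMeasure ν] (a b : ℕ) :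
    gwS ν (a + b) = gwS ν a ∗ gwS ν b := by
  apply Measure.ext_of_charFun
  ext t
  rw [charFun_conv, gwS_charFun, gwS_charFun, gwS_charFun, pow_add]

lemma gwS_add (ν : Measure ℝ) [IsProbabilityMeasure ν] (a b : ℕ) (x y : ℝ) :
    gwS ν a (Set.Ioi x) * gwS ν b (Set.Ioi y) ≤ gwS ν (a + b) (Set.Ioi (x + y)) := by
  rw [gwS_conv, Measure.conv, Measure.map_apply (by fun_prop) measurableSet_Ioi, ← Measure.prod_prod]
  apply measure_mono
  rintro ⟨u, v⟩ ⟨hu, hv⟩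
  exact add_lt_add (Set.mem_Ioi.1 hu) (Set.mem_Ioi.1 hv)

lemma gwS_block (ν : Measure ℝ) [IsProbabilityMeasure ν] (n p : ℕ) (hp : 1 ≤ p) (a : ℝ) :
    (gwS ν n (Set.Ioi a)) ^ p ≤ gwS ν (p * n) (Set.Ioi (p * a)) := by
  induction p, hp using Nat.le_induction with
  | base => simp
  | succ p hp ih =>
    rw [pow_succ, Nat.succ_mul]
    refine le_trans (by gcongr) ((gwS_add ν (p * n) n (p * a) a).trans_eq ?_)
    congr 2; push_cast; ring

lemma gwS_clt (ν : Measure ℝ) [IsProbabilityMeasure ν] (hL2 : MemLp id 2 ν)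
    (hmean : ∫ x, x ∂ν = 1) (σ2 : ℝ) (hσ : 0 < σ2) (hvar : ∫ x, (x - 1) ^ 2 ∂ν = σ2)
    (δ : ℝ) (hδ : 0 < δ) :
    ∃ A > 0, ∀ᶠ n : ℕ in atTop, Real.exp (-(A ^ 2 * (1 + δ) / (2 * σ2))) ≤
      (gwS ν n (Set.Ioi (n + A * √n))).toReal := by
  obtain ⟨A, hA, hlt⟩ := gw_gauss_lower σ2 hσ δ hδ
  refine ⟨A, hA, ?_⟩
  set P := Measure.infinitePi (fun _ : ℕ => ν) with hP
  have hmap : ∀ i : ℕ, P.map (fun w => w i) = ν := fun i => Measure.infinitePi_map_eval _ i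
  have hmp : ∀ i : ℕ, MeasurePreserving (fun w : ℕ → ℝ => w i) P ν := fun i => ⟨by fun_prop, hmap i⟩
  have hmeanP : ∫ w, w 0 ∂P = 1 := by
    rw [← hmean, ← hmap 0, integral_map (measurable_pi_apply 0).aemeasurable (by fun_prop)]
  have hvarP : Var[fun w : ℕ → ℝ => w 0; P] = σ2 := by
    rw [variance_eq_integral (measurable_pi_apply 0).aemeasurable, hmeanP, ← hvar]
    rw [← hmap 0, integral_map (measurable_pi_apply 0).aemeasurable (by fun_prop)]
  have hclt := tendstoInDistribution_inv_sqrt_mul_sum_sub (P := P) (X := fun i w => w i) (Y := id)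
    (P' := gaussianReal 0 σ2.toNNReal) (by rw [hvarP]; exact HasLaw.id)
    (hL2.comp_measurePreserving (hmp 0)) (gw_indep_pi ν)
    (fun i => ⟨(measurable_pi_apply i).aemeasurable, (measurable_pi_apply 0).aemeasurable, by rw [hmap, hmap]⟩)
  have hlim := ProbabilityMeasure.le_liminf_measure_open_of_tendsto hclt.tendsto (isOpen_Ioi (a := A))
  simp only [ProbabilityMeasure.coe_mk, Measure.map_id] at hlim
  have hev := eventually_lt_of_lt_liminf (hlt.trans_le hlim)
  filter_upwards [hev, eventually_gt_atTop 0] with n hn hn0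
  rw [← ENNReal.ofReal_le_iff_le_toReal (measure_ne_top _ _)]
  refine hn.le.trans ?_
  rw [Measure.map_apply (by fun_prop) measurableSet_Ioi, gwS, Measure.map_apply (by fun_prop) measurableSet_Ioi]
  apply measure_mono
  intro w hw
  have hs : 0 < √(n : ℝ) := by positivity
  simp only [Set.mem_preimage, Set.mem_Ioi] at hw ⊢
  rw [hmeanP, inv_mul_eq_div, lt_div_iff₀ hs] at hw
  linarith


lemma gw_Z_meas {Ω : Type*} (ms : MeasurableSpace Ω)
    (ξ : ℕ → ℕ → Ω → ℕ) (Z : ℕ → Ω → ℕ) (n : ℕ)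
    (hmeas : ∀ j i, j < n → Measurable (ξ j i))
    (hZ0 : ∀ ω, Z 0 ω = 1)
    (hZrec : ∀ n ω, Z (n + 1) ω = ∑ i ∈ Finset.range (Z n ω), ξ n i ω) :
    Measurable (Z n) := by
  induction n with
  | zero => 
    have : Z 0 = fun _ => 1 := funext hZ0
    rw [this]; exact measurable_const
  | succ n ih =>
    have h1 := ih (fun j i hj => hmeas j i (by omega))
    have h2 : Z (n + 1) = (fun p : ℕ × (ℕ → ℕ) => ∑ i ∈ Finset.range p.1, p.2 i) ∘
        (fun ω => (Z n ω, fun i => ξ n i ω)) := funext (hZrec n)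
    rw [h2]
    refine Measurable.comp ?_ (h1.prodMk (measurable_pi_iff.2 fun i => hmeas n i (by omega)))
    exact measurable_from_prod_countable_right fun k => by dsimp only; fun_prop

lemma gw_indep {Ω : Type*} [mΩ : MeasurableSpace Ω] (μ : Measure Ω) [IsProbabilityMeasure μ]
    (ξ : ℕ → ℕ → Ω → ℕ)
    (hmeas : ∀ n i, Measurable (ξ n i))
    (hindep : iIndepFun (m := fun _ : ℕ × ℕ => inferInstance)
      (fun p : ℕ × ℕ => ξ p.1 p.2) μ)
    (Z : ℕ → Ω → ℕ)
    (hZ0 : ∀ ω, Z 0 ω = 1)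
    (hZrec : ∀ n ω, Z (n + 1) ω = ∑ i ∈ Finset.range (Z n ω), ξ n i ω) (n : ℕ) :
    IndepFun (Z n) (fun ω i => ξ n i ω) μ := by
  have h := indep_iSup_of_disjoint (m := fun p : ℕ × ℕ => MeasurableSpace.comap (ξ p.1 p.2) inferInstance)
    (fun p => (hmeas p.1 p.2).comap_le) hindep (S := {p | p.1 < n}) (T := {p | p.1 = n})
    (by rw [Set.disjoint_left]; intro p hp hq; simp at hp hq; omega)
  rw [IndepFun_iff_Indep]
  refine indep_of_indep_of_le_left (indep_of_indep_of_le_right h ?_) ?_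
  · rw [← measurable_iff_comap_le]
    refine @measurable_pi_lambda _ _ _ (_) _ _ fun i => ?_
    rw [measurable_iff_comap_le]
    exact le_iSup₂_of_le (n, i) rfl le_rfl
  · rw [← measurable_iff_comap_le]
    refine gw_Z_meas _ ξ Z n (fun j i hj => ?_) hZ0 hZrec
    rw [measurable_iff_comap_le]
    exact le_iSup₂_of_le (j, i) hj le_rfl

/-- joint law -/
lemma gw_joint {Ω : Type*} [mΩ : MeasurableSpace Ω] (μ : Measure Ω) [IsProbabilityMeasure μ]
    (ξ : ℕ → ℕ → Ω → ℕ)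
    (hmeas : ∀ n i, Measurable (ξ n i))
    (hindep : iIndepFun (m := fun _ : ℕ × ℕ => inferInstance)
      (fun p : ℕ × ℕ => ξ p.1 p.2) μ)
    (Z : ℕ → Ω → ℕ)
    (hZ0 : ∀ ω, Z 0 ω = 1)
    (hZrec : ∀ n ω, Z (n + 1) ω = ∑ i ∈ Finset.range (Z n ω), ξ n i ω) (n : ℕ) :
    μ.map (fun ω => (Z n ω, fun i => ξ n i ω)) =
      (μ.map (Z n)).prod (μ.map (fun ω i => ξ n i ω)) := by
  have hZ := gw_Z_meas mΩ ξ Z n (fun j i _ => hmeas j i) hZ0 hZrec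
  have hx : Measurable (fun ω i => ξ n i ω) := measurable_pi_iff.2 (hmeas n)
  exact (indepFun_iff_map_prod_eq_prod_map_map hZ.aemeasurable hx.aemeasurable).1
    (gw_indep μ ξ hmeas hindep Z hZ0 hZrec n)

lemma gw_pgf_step {Ω : Type*} [mΩ : MeasurableSpace Ω] (μ : Measure Ω) [IsProbabilityMeasure μ]
    (ξ : ℕ → ℕ → Ω → ℕ)
    (hmeas : ∀ n i, Measurable (ξ n i))
    (hindep : iIndepFun (m := fun _ : ℕ × ℕ => inferInstance)
      (fun p : ℕ × ℕ => ξ p.1 p.2) μ)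
    (hident : ∀ n i, Measure.map (ξ n i) μ = Measure.map (ξ 0 0) μ)
    (Z : ℕ → Ω → ℕ)
    (hZ0 : ∀ ω, Z 0 ω = 1)
    (hZrec : ∀ n ω, Z (n + 1) ω = ∑ i ∈ Finset.range (Z n ω), ξ n i ω) (n : ℕ)
    (s : ℂ) (hs : ‖s‖ ≤ 1) :
    ∫ ω, s ^ (Z (n + 1) ω) ∂μ = ∫ ω, (∫ ω', s ^ (ξ 0 0 ω') ∂μ) ^ (Z n ω) ∂μ := by
  have hZ := gw_Z_meas mΩ ξ Z n (fun j i _ => hmeas j i) hZ0 hZrec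
  have hx : Measurable (fun ω i => ξ n i ω) := measurable_pi_iff.2 (hmeas n)
  have hT : Measurable (fun p : ℕ × (ℕ → ℕ) => ∑ i ∈ Finset.range p.1, p.2 i) :=
    measurable_from_prod_countable_right fun k => by dsimp only; fun_prop
  have hT2 : Measurable (fun p : ℕ × (ℕ → ℕ) => s ^ (∑ i ∈ Finset.range p.1, p.2 i)) :=
    (measurable_of_countable (fun k : ℕ => s ^ k)).comp hT
  have : IsProbabilityMeasure (μ.map (Z n)) := Measure.isProbabilityMeasure_map hZ.aemeasurable
  have : IsProbabilityMeasure (μ.map (fun ω i => ξ n i ω)) :=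
    Measure.isProbabilityMeasure_map hx.aemeasurable
  have hk : ∀ k : ℕ, ∫ y, s ^ (∑ i ∈ Finset.range k, y i) ∂(μ.map (fun ω i => ξ n i ω)) =
      (∫ ω', s ^ (ξ 0 0 ω') ∂μ) ^ k := by
    intro k
    rw [integral_map hx.aemeasurable (show Measurable (fun y : ℕ → ℕ => s ^ (∑ i ∈ Finset.range k, y i)) from
      hT2.comp (measurable_prodMk_left (x := k))).aestronglyMeasurable]
    have hin : iIndepFun (fun (i : Fin k) => ξ n i) μ :=
      hindep.precomp (g := fun i : Fin k => (n, (i : ℕ))) (fun a b h => by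
        simp only [Prod.mk.injEq, true_and] at h; exact Fin.ext h)
    have h3 := hin.integral_fun_prod_comp (f := fun _ j => s ^ j) (fun i => (hmeas n i).aemeasurable)
      (fun i => (measurable_of_countable _).aestronglyMeasurable)
    have h4 : ∀ i, ∫ ω, s ^ (ξ n i ω) ∂μ = ∫ ω, s ^ (ξ 0 0 ω) ∂μ := by
      intro i
      rw [← integral_map (f := fun j : ℕ => s ^ j) (hmeas n i).aemeasurable
        (measurable_of_countable _).aestronglyMeasurable, hident, integral_map (hmeas 0 0).aemeasurable
        (measurable_of_countable _).aestronglyMeasurable]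
    simp only [h4, Finset.prod_const, Finset.card_univ, Fintype.card_fin] at h3
    rw [← h3]
    congr with ω
    rw [Finset.prod_pow_eq_pow_sum, Finset.sum_range]
  calc ∫ ω, s ^ (Z (n + 1) ω) ∂μ 
      = ∫ p, s ^ (∑ i ∈ Finset.range p.1, p.2 i) ∂(μ.map (fun ω => (Z n ω, fun i => ξ n i ω))) := by
        rw [integral_map (hZ.prodMk hx).aemeasurable hT2.aestronglyMeasurable]
        simp [hZrec]
    _ = ∫ k, ∫ y, s ^ (∑ i ∈ Finset.range k, y i) ∂(μ.map (fun ω i => ξ n i ω)) ∂(μ.map (Z n)) := by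
        rw [gw_joint μ ξ hmeas hindep Z hZ0 hZrec n, integral_prod]
        refine Integrable.of_bound hT2.aestronglyMeasurable 1 (ae_of_all _ fun p => ?_)
        rw [norm_pow]; exact pow_le_one₀ (norm_nonneg _) hs
    _ = _ := by
        simp only [hk]
        rw [integral_map hZ.aemeasurable (measurable_of_countable _).aestronglyMeasurable]

lemma gw_norm_pgf {Ω : Type*} [mΩ : MeasurableSpace Ω] (μ : Measure Ω) [IsProbabilityMeasure μ]
    (X : Ω → ℕ) (s : ℂ) (hs : ‖s‖ ≤ 1) : ‖∫ ω, s ^ (X ω) ∂μ‖ ≤ 1 := by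
  refine (norm_integral_le_of_norm_le_const (C := 1) (ae_of_all _ fun ω => ?_)).trans (by simp)
  rw [norm_pow]; exact pow_le_one₀ (norm_nonneg _) hs

lemma gw_pgf {Ω : Type*} [mΩ : MeasurableSpace Ω] (μ : Measure Ω) [IsProbabilityMeasure μ]
    (ξ : ℕ → ℕ → Ω → ℕ)
    (hmeas : ∀ n i, Measurable (ξ n i))
    (hindep : iIndepFun (m := fun _ : ℕ × ℕ => inferInstance)
      (fun p : ℕ × ℕ => ξ p.1 p.2) μ)
    (hident : ∀ n i, Measure.map (ξ n i) μ = Measure.map (ξ 0 0) μ)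
    (Z : ℕ → Ω → ℕ)
    (hZ0 : ∀ ω, Z 0 ω = 1)
    (hZrec : ∀ n ω, Z (n + 1) ω = ∑ i ∈ Finset.range (Z n ω), ξ n i ω) (n : ℕ)
    (s : ℂ) (hs : ‖s‖ ≤ 1) :
    ∫ ω, s ^ (Z n ω) ∂μ = (fun s : ℂ => ∫ ω', s ^ (ξ 0 0 ω') ∂μ)^[n] s := by
  induction n generalizing s with
  | zero => simp [hZ0]
  | succ n ih =>
    rw [gw_pgf_step μ ξ hmeas hindep hident Z hZ0 hZrec n s hs, ih _ (gw_norm_pgf μ _ s hs)]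
    rfl

lemma gw_pgf_outer {Ω : Type*} [mΩ : MeasurableSpace Ω] (μ : Measure Ω) [IsProbabilityMeasure μ]
    (ξ : ℕ → ℕ → Ω → ℕ)
    (hmeas : ∀ n i, Measurable (ξ n i))
    (hindep : iIndepFun (m := fun _ : ℕ × ℕ => inferInstance)
      (fun p : ℕ × ℕ => ξ p.1 p.2) μ)
    (hident : ∀ n i, Measure.map (ξ n i) μ = Measure.map (ξ 0 0) μ)
    (Z : ℕ → Ω → ℕ)
    (hZ0 : ∀ ω, Z 0 ω = 1)
    (hZrec : ∀ n ω, Z (n + 1) ω = ∑ i ∈ Finset.range (Z n ω), ξ n i ω) (n : ℕ)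
    (s : ℂ) (hs : ‖s‖ ≤ 1) :
    ∫ ω, s ^ (Z (n + 1) ω) ∂μ = ∫ ω', (∫ ω, s ^ (Z n ω) ∂μ) ^ (ξ 0 0 ω') ∂μ := by
  rw [gw_pgf μ ξ hmeas hindep hident Z hZ0 hZrec (n + 1) s hs,
    gw_pgf μ ξ hmeas hindep hident Z hZ0 hZrec n s hs, Function.iterate_succ_apply']

lemma gw_charFun_eq {Ω : Type*} [mΩ : MeasurableSpace Ω] (μ : Measure Ω) [IsProbabilityMeasure μ]
    (ξ : ℕ → ℕ → Ω → ℕ)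
    (hmeas : ∀ n i, Measurable (ξ n i))
    (hindep : iIndepFun (m := fun _ : ℕ × ℕ => inferInstance)
      (fun p : ℕ × ℕ => ξ p.1 p.2) μ)
    (hident : ∀ n i, Measure.map (ξ n i) μ = Measure.map (ξ 0 0) μ)
    (m : ℝ) (hm1 : 1 < m)
    (Z : ℕ → Ω → ℕ)
    (hZ0 : ∀ ω, Z 0 ω = 1)
    (hZrec : ∀ n ω, Z (n + 1) ω = ∑ i ∈ Finset.range (Z n ω), ξ n i ω)
    (Wlim : Ω → ℝ) (hWm : AEMeasurable Wlim μ)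
    (hWlim : ∀ᵐ ω ∂μ, Tendsto (fun n => (Z n ω : ℝ) / m ^ n) atTop (nhds (Wlim ω))) (t : ℝ) :
    charFun (μ.map Wlim) t = ∫ ω, (charFun (μ.map Wlim) (t / m)) ^ (ξ 0 0 ω) ∂μ := by
  have hm0 : m ≠ 0 := by linarith
  let s : ℝ → ℕ → ℂ := fun t n => Complex.exp (((t / m ^ n : ℝ) : ℂ) * Complex.I)
  have hs : ∀ t n, ‖s t n‖ ≤ 1 := fun t n => (Complex.norm_exp_ofReal_mul_I _).le
  have hZ := fun n => gw_Z_meas mΩ ξ Z n (fun j i _ => hmeas j i) hZ0 hZrec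
  have hlim : ∀ t : ℝ, Tendsto (fun n => ∫ ω, s t n ^ (Z n ω) ∂μ) atTop
      (nhds (charFun (μ.map Wlim) t)) := by
    intro t
    rw [charFun_apply_real, integral_map hWm (by fun_prop)]
    refine tendsto_integral_of_dominated_convergence (fun _ => 1) 
      (fun n => ((measurable_of_countable (fun k : ℕ => s t n ^ k)).comp (hZ n)).aestronglyMeasurable) 
      (by simp) (fun n => ae_of_all _ fun ω => ?_) ?_
    · rw [norm_pow]; exact pow_le_one₀ (norm_nonneg _) (hs t n)
    · filter_upwards [hWlim] with ω hω
      have h1 : ∀ n, s t n ^ (Z n ω) = Complex.exp ((t : ℂ) * (((Z n ω : ℝ) / m ^ n : ℝ) : ℂ) * Complex.I) := by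
        intro n
        simp only [s]
        rw [← Complex.exp_nat_mul]
        congr 1; push_cast; ring
      simp only [h1]
      have hc : Continuous (fun x : ℝ => Complex.exp ((t : ℂ) * (x : ℂ) * Complex.I)) := by fun_prop
      exact (hc.tendsto _).comp hω
  have hrec : ∀ n, ∫ ω, s t (n + 1) ^ (Z (n + 1) ω) ∂μ = 
      ∫ ω', (∫ ω, s (t / m) n ^ (Z n ω) ∂μ) ^ (ξ 0 0 ω') ∂μ := by
    intro n
    rw [gw_pgf_outer μ ξ hmeas hindep hident Z hZ0 hZrec n _ (hs t (n + 1))]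
    have : s t (n + 1) = s (t / m) n := by
      simp only [s]; congr 3; rw [pow_succ', div_div]
    rw [this]
  have h1 := (hlim t).comp (tendsto_add_atTop_nat 1)
  refine tendsto_nhds_unique h1 ?_
  simp only [Function.comp_def, hrec]
  refine tendsto_integral_of_dominated_convergence (fun _ => 1) 
      (fun n => ((measurable_of_countable (fun k : ℕ => (∫ ω, s (t / m) n ^ (Z n ω) ∂μ) ^ k)).comp (hmeas 0 0)).aestronglyMeasurable) 
      (by simp) (fun n => ae_of_all _ fun ω => ?_) (ae_of_all _ fun ω => ?_)
  · rw [norm_pow]; exact pow_le_one₀ (norm_nonneg _) (gw_norm_pgf μ _ _ (hs _ _))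
  · exact (hlim (t / m)).pow _

lemma gw_fixed (ρ : Measure ℕ) [IsProbabilityMeasure ρ] (ν : Measure ℝ) [IsProbabilityMeasure ν]
    (m : ℝ) (hm : 0 < m) (hν : ∀ᵐ x ∂ν, 0 ≤ x)
    (h : ∀ t, charFun ν t = ∫ k, (charFun ν (t / m)) ^ k ∂ρ) (k : ℕ) (x : ℝ) :
    ρ (Set.Ici k) * gwS ν k (Set.Ioi (m * x)) ≤ ν (Set.Ioi x) := by
  set P := Measure.infinitePi (fun _ : ℕ => ν) with hP
  have hT : Measurable (fun p : ℕ × (ℕ → ℝ) => (∑ i ∈ Finset.range p.1, p.2 i) / m) :=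
    measurable_from_prod_countable_right fun k => by dsimp only; fun_prop
  have hlaw : (ρ.prod P).map (fun p : ℕ × (ℕ → ℝ) => (∑ i ∈ Finset.range p.1, p.2 i) / m) = ν := by
    have : IsProbabilityMeasure ((ρ.prod P).map (fun p : ℕ × (ℕ → ℝ) => (∑ i ∈ Finset.range p.1, p.2 i) / m)) :=
      Measure.isProbabilityMeasure_map hT.aemeasurable
    apply Measure.ext_of_charFun
    ext t
    have hg : Measurable (fun x : ℝ => Complex.exp ((t : ℂ) * (x : ℂ) * Complex.I)) := by fun_prop
    rw [charFun_apply_real, integral_map hT.aemeasurable hg.aestronglyMeasurable, integral_prod, h t]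
    · congr with k
      rw [← gwS_charFun, charFun_apply_real, gwS, integral_map (by fun_prop) (by fun_prop)]
      congr with w
      congr 2; push_cast; ring
    · refine Integrable.of_bound (hg.comp hT).aestronglyMeasurable 1 (ae_of_all _ fun p => ?_)
      rw [← Complex.ofReal_mul, Complex.norm_exp_ofReal_mul_I]
  have hpos : ∀ᵐ w ∂P, ∀ i, 0 ≤ w i := by
    rw [ae_all_iff]
    intro i
    have : MeasurePreserving (fun w : ℕ → ℝ => w i) P ν := 
      ⟨measurable_pi_apply i, Measure.infinitePi_map_eval _ i⟩
    exact this.quasiMeasurePreserving.ae hν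
  conv_rhs => rw [← hlaw]
  rw [Measure.map_apply hT measurableSet_Ioi, gwS, Measure.map_apply (by fun_prop) measurableSet_Ioi,
    ← Measure.prod_prod]
  apply measure_mono_ae
  have h2 : ∀ᵐ p ∂(ρ.prod P), ∀ i, 0 ≤ p.2 i :=
    Measure.quasiMeasurePreserving_snd.ae hpos
  filter_upwards [h2] with p hp hmem
  obtain ⟨h3, h4⟩ := hmem
  simp only [Set.mem_Ici, Set.mem_preimage, Set.mem_Ioi] at h3 h4
  change x < (∑ i ∈ Finset.range p.1, p.2 i) / m
  rw [lt_div_iff₀ hm, mul_comm]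
  exact h4.trans_le (Finset.sum_le_sum_of_subset_of_nonneg (Finset.range_mono h3) fun i _ _ => hp i)


lemma gw_second_moment {Ω : Type*} [mΩ : MeasurableSpace Ω] (μ : Measure Ω) [IsProbabilityMeasure μ]
    (X : Ω → ℕ) (hX : Measurable X) (β : ℝ) (hβ : 0 < β)
    (htail : Tendsto (fun x : ℝ => (μ {ω | x < (X ω : ℝ)}).toReal / Real.exp (-(x ^ β))) atTop (nhds 1)) :
    ∫⁻ ω, (X ω : ENNReal) ^ 2 ∂μ ≠ ⊤ := by
  have h2 : ∀ᶠ x : ℝ in atTop, (μ {ω | x < (X ω : ℝ)}).toReal / Real.exp (-(x ^ β)) < 2 :=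
    htail.eventually (gt_mem_nhds (by norm_num))
  obtain ⟨X1, hX1⟩ := eventually_atTop.1 h2
  set X0 := max X1 1 with hX0
  have hlc := lintegral_rpow_eq_lintegral_meas_lt_mul μ (f := fun ω => (X ω : ℝ)) (p := 2)
    (ae_of_all _ fun ω => Nat.cast_nonneg _) 
    ((measurable_of_countable (fun k : ℕ => (k : ℝ))).comp hX).aemeasurable (by norm_num)
  have he : ∀ ω, (X ω : ENNReal) ^ 2 = ENNReal.ofReal ((X ω : ℝ) ^ (2 : ℝ)) := by
    intro ω
    rw [Real.rpow_two, ENNReal.ofReal_pow (by positivity), ENNReal.ofReal_natCast]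
  simp only [he]
  rw [hlc]
  refine ENNReal.mul_ne_top ENNReal.ofReal_ne_top ?_
  have hsub : Set.Ioi (0 : ℝ) ⊆ Set.Ioc 0 X0 ∪ Set.Ioi X0 := by
    intro t ht
    rcases le_or_gt t X0 with h | h
    · exact Or.inl ⟨ht, h⟩
    · exact Or.inr h
  have hint := (integrableOn_rpow_mul_exp_neg_rpow (p := β) (s := 1) (by norm_num) hβ).const_mul 2
  have hle : ∫⁻ t in Set.Ioi (0 : ℝ), μ {a | t < (X a : ℝ)} * ENNReal.ofReal (t ^ ((2 : ℝ) - 1)) ≤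
      ENNReal.ofReal X0 * ENNReal.ofReal X0 + 
      ∫⁻ t in Set.Ioi (0 : ℝ), ENNReal.ofReal (2 * (t ^ (1 : ℝ) * Real.exp (-t ^ β))) := by
    refine (lintegral_mono_set hsub).trans ((lintegral_union_le _ _ _).trans ?_)
    gcongr ?_ + ?_
    · calc _ ≤ ∫⁻ t in Set.Ioc 0 X0, ENNReal.ofReal X0 := by
            refine setLIntegral_mono' measurableSet_Ioc fun t ht => ?_
            calc _ ≤ 1 * ENNReal.ofReal (t ^ ((2 : ℝ) - 1)) := by gcongr; exact prob_le_one
              _ ≤ _ := by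
                rw [one_mul]; apply ENNReal.ofReal_le_ofReal
                norm_num; exact ht.2
        _ = _ := by simp
    · calc _ ≤ ∫⁻ t in Set.Ioi X0, ENNReal.ofReal (2 * (t ^ (1 : ℝ) * Real.exp (-t ^ β))) := by
            refine setLIntegral_mono' measurableSet_Ioi fun t ht => ?_
            have ht' : X0 < t := ht
            have h1 : X1 ≤ t := (le_max_left X1 1).trans ht'.le
            have h0 : 0 < t := by linarith [le_max_right X1 1]
            have h3 := (div_lt_iff₀ (Real.exp_pos _)).1 (hX1 t h1)
            rw [← ENNReal.ofReal_toReal (measure_ne_top μ {a | t < (X a : ℝ)}), 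
              ← ENNReal.ofReal_mul ENNReal.toReal_nonneg]
            apply ENNReal.ofReal_le_ofReal
            norm_num
            nlinarith
        _ ≤ _ := lintegral_mono_set (Set.Ioi_subset_Ioi (by linarith [le_max_right X1 1]))
  refine ne_top_of_le_ne_top ?_ hle
  refine ENNReal.add_ne_top.2 ⟨ENNReal.mul_ne_top ENNReal.ofReal_ne_top ENNReal.ofReal_ne_top, ?_⟩
  exact (hint.lintegral_lt_top).ne

lemma gw_limit_moments {Ω : Type*} [mΩ : MeasurableSpace Ω] (μ : Measure Ω) [IsProbabilityMeasure μ]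
    (X : ℕ → Ω → ℝ) (hX : ∀ n, Measurable (X n)) (hpos : ∀ n ω, 0 ≤ X n ω)
    (h1 : ∀ n, ∫⁻ ω, ENNReal.ofReal (X n ω) ∂μ = 1) (C : ℝ) (hC : 0 ≤ C)
    (h2 : ∀ n, ∫⁻ ω, ENNReal.ofReal (X n ω ^ 2) ∂μ ≤ ENNReal.ofReal C)
    (Y : Ω → ℝ) (hY : AEMeasurable Y μ)
    (hlim : ∀ᵐ ω ∂μ, Tendsto (fun n => X n ω) atTop (nhds (Y ω))) :
    MemLp Y 2 μ ∧ ∫ ω, Y ω ∂μ = 1 := by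
  have hYpos : ∀ᵐ ω ∂μ, 0 ≤ Y ω := by
    filter_upwards [hlim] with ω hω
    exact ge_of_tendsto' hω fun n => hpos n ω
  have hY2 : MemLp Y 2 μ := by
    rw [memLp_two_iff_integrable_sq hY.aestronglyMeasurable]
    refine ⟨(hY.pow_const 2).aestronglyMeasurable, ?_⟩
    rw [hasFiniteIntegral_iff_ofReal (ae_of_all _ fun ω => sq_nonneg _)]
    calc ∫⁻ ω, ENNReal.ofReal (Y ω ^ 2) ∂μ = ∫⁻ ω, liminf (fun n => ENNReal.ofReal (X n ω ^ 2)) atTop ∂μ := by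
          apply lintegral_congr_ae
          filter_upwards [hlim] with ω hω
          exact ((ENNReal.continuous_ofReal.tendsto _).comp (hω.pow 2)).liminf_eq.symm
      _ ≤ liminf (fun n => ∫⁻ ω, ENNReal.ofReal (X n ω ^ 2) ∂μ) atTop :=
          lintegral_liminf_le fun n => ((hX n).pow_const 2).ennreal_ofReal
      _ ≤ ENNReal.ofReal C := by
          refine (liminf_le_liminf (Eventually.of_forall h2)).trans ?_
          simp
      _ < ⊤ := ENNReal.ofReal_lt_top
  refine ⟨hY2, ?_⟩
  have hYi : Integrable Y μ := hY2.integrable (by norm_num)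
  have hXi : ∀ n, Integrable (X n) μ := fun n => 
    ⟨(hX n).aestronglyMeasurable, by 
      rw [hasFiniteIntegral_iff_ofReal (ae_of_all _ (hpos n)), h1]; simp⟩
  have hXi2 : ∀ n, Integrable (fun ω => X n ω ^ 2) μ := fun n => 
    ⟨((hX n).pow_const 2).aestronglyMeasurable, by 
      rw [hasFiniteIntegral_iff_ofReal (ae_of_all _ fun ω => sq_nonneg _)]
      exact (h2 n).trans_lt ENNReal.ofReal_lt_top⟩
  have hI1 : ∀ n, ∫ ω, X n ω ∂μ = 1 := by
    intro n
    rw [integral_eq_lintegral_of_nonneg_ae (ae_of_all _ (hpos n)) (hX n).aestronglyMeasurable, h1]; simp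
  have hI2 : ∀ n, ∫ ω, X n ω ^ 2 ∂μ ≤ C := by
    intro n
    rw [integral_eq_lintegral_of_nonneg_ae (ae_of_all _ fun ω => sq_nonneg _) ((hX n).pow_const 2).aestronglyMeasurable]
    exact ENNReal.toReal_le_of_le_ofReal hC (h2 n)
  have hmi : ∀ n (K : ℝ), Integrable (fun ω => min (X n ω) K) μ := 
    fun n K => (hXi n).inf (integrable_const K)
  have hlow : ∀ (K : ℝ), 0 < K → 1 - C / K ≤ ∫ ω, min (Y ω) K ∂μ ∧ ∫ ω, min (Y ω) K ∂μ ≤ 1 := by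
    intro K hK
    have ht : Tendsto (fun n => ∫ ω, min (X n ω) K ∂μ) atTop (nhds (∫ ω, min (Y ω) K ∂μ)) := by
      refine tendsto_integral_of_dominated_convergence (fun _ => K) 
        (fun n => (hmi n K).aestronglyMeasurable) (integrable_const K) 
        (fun n => ae_of_all _ fun ω => ?_) ?_
      · rw [Real.norm_of_nonneg (le_min (hpos n ω) hK.le)]; exact min_le_right _ _
      · filter_upwards [hlim] with ω hω
        exact hω.min tendsto_const_nhds
    constructor
    · refine ge_of_tendsto' ht fun n => ?_
      calc 1 - C / K ≤ (∫ ω, X n ω ∂μ) - (∫ ω, X n ω ^ 2 ∂μ) / K := by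
            rw [hI1]; gcongr; exact hI2 n
        _ = ∫ ω, (X n ω - X n ω ^ 2 / K) ∂μ := by
            rw [integral_sub (hXi n) ((hXi2 n).div_const K), integral_div]
        _ ≤ _ := by
            refine integral_mono ((hXi n).sub ((hXi2 n).div_const K)) (hmi n K) fun ω => ?_
            have hx := hpos n ω
            apply le_min
            · simp; positivity
            · rw [sub_le_iff_le_add, ← sub_le_iff_le_add', le_div_iff₀ hK]
              nlinarith [sq_nonneg (X n ω - K)]
    · refine le_of_tendsto' ht fun n => ?_
      rw [← hI1 n]
      exact integral_mono (hmi n K) (hXi n) fun ω => min_le_left _ _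
  have ht2 : Tendsto (fun K : ℕ => ∫ ω, min (Y ω) (K : ℝ) ∂μ) atTop (nhds (∫ ω, Y ω ∂μ)) := by
    refine tendsto_integral_of_dominated_convergence Y
      (fun n => (hYi.inf (integrable_const (n : ℝ))).aestronglyMeasurable) hYi (fun n => ?_) ?_
    · filter_upwards [hYpos] with ω hω
      rw [Real.norm_of_nonneg (le_min hω (Nat.cast_nonneg _))]; exact min_le_left _ _
    · refine ae_of_all _ fun ω => ?_
      refine tendsto_const_nhds.congr' ?_
      filter_upwards [tendsto_natCast_atTop_atTop.eventually_ge_atTop (Y ω)] with K hK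
      exact (min_eq_left hK).symm
  have ht3 : Tendsto (fun K : ℕ => ∫ ω, min (Y ω) (K : ℝ) ∂μ) atTop (nhds 1) := by
    have hl : Tendsto (fun K : ℕ => 1 - C / (K : ℝ)) atTop (nhds 1) := by
      simpa using (tendsto_const_div_atTop_nhds_zero_nat C).const_sub 1
    refine tendsto_of_tendsto_of_tendsto_of_le_of_le' hl tendsto_const_nhds ?_ ?_
    · filter_upwards [eventually_gt_atTop 0] with K hK
      exact (hlow K (by exact_mod_cast hK)).1
    · filter_upwards [eventually_gt_atTop 0] with K hK
      exact (hlow K (by exact_mod_cast hK)).2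
  exact tendsto_nhds_unique ht2 ht3

lemma gw_lint_step {Ω : Type*} [mΩ : MeasurableSpace Ω] (μ : Measure Ω) [IsProbabilityMeasure μ]
    (ξ : ℕ → ℕ → Ω → ℕ)
    (hmeas : ∀ n i, Measurable (ξ n i))
    (hindep : iIndepFun (m := fun _ : ℕ × ℕ => inferInstance)
      (fun p : ℕ × ℕ => ξ p.1 p.2) μ)
    (Z : ℕ → Ω → ℕ)
    (hZ0 : ∀ ω, Z 0 ω = 1)
    (hZrec : ∀ n ω, Z (n + 1) ω = ∑ i ∈ Finset.range (Z n ω), ξ n i ω) (n : ℕ)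
    (h : ℕ → ENNReal) :
    ∫⁻ ω, h (Z (n + 1) ω) ∂μ = ∫⁻ ω, ∫⁻ ω', h (∑ i ∈ Finset.range (Z n ω), ξ n i ω') ∂μ ∂μ := by
  have hZ := gw_Z_meas mΩ ξ Z n (fun j i _ => hmeas j i) hZ0 hZrec
  have hx : Measurable (fun ω i => ξ n i ω) := measurable_pi_iff.2 (hmeas n)
  have hT : Measurable (fun p : ℕ × (ℕ → ℕ) => ∑ i ∈ Finset.range p.1, p.2 i) :=
    measurable_from_prod_countable_right fun k => by dsimp only; fun_prop
  have hT2 : Measurable (fun p : ℕ × (ℕ → ℕ) => h (∑ i ∈ Finset.range p.1, p.2 i)) :=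
    (measurable_of_countable h).comp hT
  have : IsProbabilityMeasure (μ.map (Z n)) := Measure.isProbabilityMeasure_map hZ.aemeasurable
  have : IsProbabilityMeasure (μ.map (fun ω i => ξ n i ω)) :=
    Measure.isProbabilityMeasure_map hx.aemeasurable
  calc ∫⁻ ω, h (Z (n + 1) ω) ∂μ 
      = ∫⁻ p, h (∑ i ∈ Finset.range p.1, p.2 i) ∂(μ.map (fun ω => (Z n ω, fun i => ξ n i ω))) := by
        rw [lintegral_map hT2 (hZ.prodMk hx)]
        simp [hZrec]
    _ = ∫⁻ k, ∫⁻ y, h (∑ i ∈ Finset.range k, y i) ∂(μ.map (fun ω i => ξ n i ω)) ∂(μ.map (Z n)) := by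
        rw [gw_joint μ ξ hmeas hindep Z hZ0 hZrec n, lintegral_prod _ hT2.aemeasurable]
    _ = ∫⁻ k, ∫⁻ ω', h (∑ i ∈ Finset.range k, ξ n i ω') ∂μ ∂(μ.map (Z n)) := by
        congr with k
        rw [lintegral_map (show Measurable (fun y : ℕ → ℕ => h (∑ i ∈ Finset.range k, y i)) from
          hT2.comp (measurable_prodMk_left (x := k))) hx]
    _ = _ := by
        rw [lintegral_map (measurable_of_countable _) hZ]

lemma gw_sum_moments {Ω : Type*} [mΩ : MeasurableSpace Ω] (μ : Measure Ω) [IsProbabilityMeasure μ]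
    (X : ℕ → Ω → ℕ) (hX : ∀ i, Measurable (X i)) (hindep : iIndepFun X μ) (M B : ENNReal)
    (hM : ∀ i, ∫⁻ ω, (X i ω : ENNReal) ∂μ = M) (hB : ∀ i, ∫⁻ ω, (X i ω : ENNReal) ^ 2 ∂μ = B) (k : ℕ) :
    ∫⁻ ω, ((∑ i ∈ Finset.range k, X i ω : ℕ) : ENNReal) ∂μ = k * M ∧ 
    ∫⁻ ω, ((∑ i ∈ Finset.range k, X i ω : ℕ) : ENNReal) ^ 2 ∂μ ≤ k * B + k ^ 2 * M ^ 2 := by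
  have hc : Measurable (fun j : ℕ => (j : ENNReal)) := measurable_of_countable _
  have hXe : ∀ i, Measurable (fun ω => (X i ω : ENNReal)) := fun i => hc.comp (hX i)
  have hSm : ∀ k, Measurable (fun ω => ∑ i ∈ Finset.range k, X i ω) := fun k => by fun_prop
  have hSe : ∀ k, Measurable (fun ω => ((∑ i ∈ Finset.range k, X i ω : ℕ) : ENNReal)) := fun k => hc.comp (hSm k)
  induction k with
  | zero => simp
  | succ k ih =>
    obtain ⟨ih1, ih2⟩ := ih
    have hi : IndepFun (fun ω => ∑ i ∈ Finset.range k, X i ω) (X k) μ := by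
      have := hindep.indepFun_sum_range_succ hX k
      convert this using 1
      ext ω; simp
    have hie := hi.comp hc hc
    have hmul : ∫⁻ ω, ((∑ i ∈ Finset.range k, X i ω : ℕ) : ENNReal) * (X k ω : ENNReal) ∂μ = k * M * M := by
      have := lintegral_mul_eq_lintegral_mul_lintegral_of_indepFun (hSe k) (hXe k) hie
      simp only [Pi.mul_apply] at this
      rw [this, ih1, hM]
    constructor
    · simp only [Finset.sum_range_succ]
      simp only [Nat.cast_add]
      rw [lintegral_add_left (hSe k), ih1, hM]; push_cast; ring
    · have hexp : ∀ ω, ((∑ i ∈ Finset.range (k + 1), X i ω : ℕ) : ENNReal) ^ 2 = 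
          ((∑ i ∈ Finset.range k, X i ω : ℕ) : ENNReal) ^ 2 + 
          (2 * (((∑ i ∈ Finset.range k, X i ω : ℕ) : ENNReal) * (X k ω : ENNReal)) + (X k ω : ENNReal) ^ 2) := by
        intro ω
        rw [Finset.sum_range_succ, Nat.cast_add]; ring
      simp only [hexp]
      rw [lintegral_add_left ((hSe k).pow_const 2), lintegral_add_right _ ((hXe k).pow_const 2),
        lintegral_const_mul' _ _ (by simp), hmul, hB]
      calc _ ≤ (k * B + k ^ 2 * M ^ 2) + (2 * (k * M * M) + B) := by gcongr
        _ ≤ (k * B + k ^ 2 * M ^ 2) + (2 * (k * M * M) + B) + M ^ 2 := le_self_add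
        _ = _ := by push_cast; ring

lemma gw_Z_moments {Ω : Type*} [mΩ : MeasurableSpace Ω] (μ : Measure Ω) [IsProbabilityMeasure μ]
    (ξ : ℕ → ℕ → Ω → ℕ)
    (hmeas : ∀ n i, Measurable (ξ n i))
    (hindep : iIndepFun (m := fun _ : ℕ × ℕ => inferInstance)
      (fun p : ℕ × ℕ => ξ p.1 p.2) μ)
    (hident : ∀ n i, Measure.map (ξ n i) μ = Measure.map (ξ 0 0) μ)
    (Z : ℕ → Ω → ℕ)
    (hZ0 : ∀ ω, Z 0 ω = 1)
    (hZrec : ∀ n ω, Z (n + 1) ω = ∑ i ∈ Finset.range (Z n ω), ξ n i ω)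
    (m b : ℝ) (hm1 : 1 < m) (hb : 0 ≤ b) 
    (hM : ∫⁻ ω, (ξ 0 0 ω : ENNReal) ∂μ = ENNReal.ofReal m)
    (hB : ∫⁻ ω, (ξ 0 0 ω : ENNReal) ^ 2 ∂μ = ENNReal.ofReal b) (n : ℕ) :
    ∫⁻ ω, (Z n ω : ENNReal) ∂μ = ENNReal.ofReal (m ^ n) ∧ 
    ∫⁻ ω, (Z n ω : ENNReal) ^ 2 ∂μ ≤ 
      ENNReal.ofReal (m ^ (2 * n) + b / (m ^ 2 - m) * (m ^ (2 * n) - m ^ n)) := by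
  have hD : 0 < m ^ 2 - m := by nlinarith
  have hm0 : 0 < m := by linarith
  have hc : Measurable (fun j : ℕ => (j : ENNReal)) := measurable_of_countable _
  have hid : ∀ (h : ℕ → ENNReal) n i, ∫⁻ ω, h (ξ n i ω) ∂μ = ∫⁻ ω, h (ξ 0 0 ω) ∂μ := by
    intro h n i
    rw [← lintegral_map (measurable_of_countable h) (hmeas n i), hident, 
      lintegral_map (measurable_of_countable h) (hmeas 0 0)]
  have hsum : ∀ n k, _ := fun n k => gw_sum_moments μ (ξ n) (hmeas n)
    (hindep.precomp (g := fun i : ℕ => (n, i)) (fun a b h => by simpa using h)) 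
    (ENNReal.ofReal m) (ENNReal.ofReal b)
    (fun i => by rw [← hM]; exact hid (fun j => (j : ENNReal)) n i)
    (fun i => by rw [← hB]; exact hid (fun j => (j : ENNReal) ^ 2) n i) k
  have hZ := fun n => gw_Z_meas mΩ ξ Z n (fun j i _ => hmeas j i) hZ0 hZrec
  have hZe : ∀ n, Measurable (fun ω => (Z n ω : ENNReal)) := fun n => hc.comp (hZ n)
  induction n with
  | zero => simp [hZ0]
  | succ n ih =>
    obtain ⟨ih1, ih2⟩ := ih
    constructor
    · rw [gw_lint_step μ ξ hmeas hindep Z hZ0 hZrec n (fun j => (j : ENNReal))]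
      simp only [(hsum _ _).1]
      rw [lintegral_mul_const _ (hZe n), ih1, ← ENNReal.ofReal_mul (by positivity), pow_succ]
    · rw [gw_lint_step μ ξ hmeas hindep Z hZ0 hZrec n (fun j => (j : ENNReal) ^ 2)]
      have hmn : m ^ n ≤ m ^ (2 * n) := pow_le_pow_right₀ hm1.le (by omega)
      calc _ ≤ ∫⁻ ω, ((Z n ω : ENNReal) * ENNReal.ofReal b + (Z n ω : ENNReal) ^ 2 * (ENNReal.ofReal m) ^ 2) ∂μ :=
            lintegral_mono fun ω => (hsum n (Z n ω)).2
        _ = ENNReal.ofReal (m ^ n) * ENNReal.ofReal b + (∫⁻ ω, (Z n ω : ENNReal) ^ 2 ∂μ) * (ENNReal.ofReal m) ^ 2 := by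
            rw [lintegral_add_left ((hZe n).mul_const _), lintegral_mul_const _ (hZe n), ih1, 
              lintegral_mul_const _ ((hZe n).pow_const 2)]
        _ ≤ ENNReal.ofReal (m ^ n) * ENNReal.ofReal b + 
            ENNReal.ofReal (m ^ (2 * n) + b / (m ^ 2 - m) * (m ^ (2 * n) - m ^ n)) * (ENNReal.ofReal m) ^ 2 := by
            gcongr
        _ = _ := by
            have : 0 ≤ m ^ (2 * n) + b / (m ^ 2 - m) * (m ^ (2 * n) - m ^ n) := by
              have : 0 ≤ m ^ (2 * n) - m ^ n := by linarith
              positivity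
            rw [← ENNReal.ofReal_pow hm0.le, ← ENNReal.ofReal_mul (by positivity), ← ENNReal.ofReal_mul this,
              ← ENNReal.ofReal_add (by positivity) (by positivity)]
            congr 1
            have hm1' : m - 1 ≠ 0 := by linarith
            field_simp
            ring


lemma gwS_one (ν : Measure ℝ) [IsProbabilityMeasure ν] : gwS ν 1 = ν := by
  apply Measure.ext_of_charFun
  ext t
  rw [gwS_charFun, pow_one]

lemma gw_sigma_pos (ρ : Measure ℕ) [IsProbabilityMeasure ρ] (ν : Measure ℝ) [IsProbabilityMeasure ν]
    (m : ℝ) (hρ : ∀ k : ℕ, 0 < ρ (Set.Ici k)) (hL2 : MemLp id 2 ν)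
    (h : ∀ (k : ℕ) (x : ℝ), ρ (Set.Ici k) * gwS ν k (Set.Ioi (m * x)) ≤ ν (Set.Ioi x)) :
    0 < ∫ x, (x - 1) ^ 2 ∂ν := by
  have h0 : 0 ≤ ∫ x, (x - 1) ^ 2 ∂ν := integral_nonneg fun x => sq_nonneg _
  rcases h0.lt_or_eq with h1 | h1
  · exact h1
  exfalso
  have hint : Integrable (fun x : ℝ => (x - 1) ^ 2) ν :=
    (hL2.sub (memLp_const (1 : ℝ))).integrable_sq
  have h2 := (integral_eq_zero_iff_of_nonneg (fun x => sq_nonneg _) hint).1 h1.symm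
  have h3 : ∀ᵐ x ∂ν, x = 1 := by
    filter_upwards [h2] with x hx
    have : (x - 1) ^ 2 = 0 := hx
    have := pow_eq_zero_iff (two_ne_zero) |>.1 this
    linarith
  have h4 : ν (Set.Ioi 2) = 0 := by
    rw [← compl_compl (Set.Ioi (2:ℝ)), ← mem_ae_iff]
    filter_upwards [h3] with x hx
    simp [hx]
  have h5 : ν (Set.Ioi (1/2)) = 1 := by
    rw [← mem_ae_iff_prob_eq_one measurableSet_Ioi]
    filter_upwards [h3] with x hx
    simp only [Set.mem_Ioi, hx]; norm_num
  obtain ⟨k, hk⟩ := exists_nat_gt (max 1 (4 * m))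
  have hk1 : (1:ℝ) < k := lt_of_le_of_lt (le_max_left _ _) hk
  have hk2 : 4 * m < k := lt_of_le_of_lt (le_max_right _ _) hk
  have hb := gwS_block ν 1 k (by exact_mod_cast hk1.le) (1/2)
  rw [gwS_one, h5, one_pow, mul_one] at hb
  have hc : (1 : ENNReal) ≤ gwS ν k (Set.Ioi (m * 2)) :=
    hb.trans (measure_mono (Set.Ioi_subset_Ioi (by linarith)))
  have hd := h k 2
  rw [h4, nonpos_iff_eq_zero, mul_eq_zero] at hd
  rcases hd with hd | hd
  · exact (hρ k).ne' hd
  · rw [hd] at hc; simp at hc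

/-- If `ℙ(ξ > x) ~ e^{-x^β}` with `β ∈ (1/2, 1)` and
`σ² := E(W-1)²`, then
`ℙ(W > x) ≥ exp{-(mx)^β + (β²σ²/2)(mx)^{2β-1}(1+o(1))}` as `x → ∞`;
in particular `ℙ(W > x)/F̄(mx) → ∞`. -/
theorem gw_weibull_large_beta_lower_bound
    {Ω : Type*} [MeasurableSpace Ω] (μ : Measure Ω) [IsProbabilityMeasure μ]
    (ξ : ℕ → ℕ → Ω → ℕ)
    (hmeas : ∀ n i, Measurable (ξ n i))
    (hindep : iIndepFun (m := fun _ : ℕ × ℕ => inferInstance)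
      (fun p : ℕ × ℕ => ξ p.1 p.2) μ)
    (hident : ∀ n i, Measure.map (ξ n i) μ = Measure.map (ξ 0 0) μ)
    (hint : Integrable (fun ω => (ξ 0 0 ω : ℝ)) μ)
    (m : ℝ) (hm : m = ∫ ω, (ξ 0 0 ω : ℝ) ∂μ) (hm1 : 1 < m)
    (Z : ℕ → Ω → ℕ)
    (hZ0 : ∀ ω, Z 0 ω = 1)
    (hZrec : ∀ n ω, Z (n + 1) ω = ∑ i ∈ Finset.range (Z n ω), ξ n i ω)
    (W : ℕ → Ω → ℝ) (hW : ∀ n ω, W n ω = (Z n ω : ℝ) / m ^ n)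
    (Fbar : ℝ → ℝ) (hFbar : ∀ x, Fbar x = (μ {ω | x < (ξ 0 0 ω : ℝ)}).toReal)
    (Wlim : Ω → ℝ)
    (hWlim : ∀ᵐ ω ∂μ, Tendsto (fun n => W n ω) atTop (nhds (Wlim ω)))
    (β : ℝ) (hβ : 1 / 2 < β) (hβ1 : β < 1)
    -- `ℙ(ξ > x) ~ e^{-x^β}`
    (htail : Tendsto (fun x : ℝ => Fbar x / Real.exp (-(x ^ β))) atTop (nhds 1))
    (σ2 : ℝ) (hσ2 : σ2 = ∫ ω, (Wlim ω - 1) ^ 2 ∂μ) :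
    (∃ e : ℝ → ℝ, Tendsto e atTop (nhds 0) ∧
      ∀ᶠ x : ℝ in atTop,
        Real.exp (-((m * x) ^ β) +
            β ^ 2 * σ2 / 2 * (m * x) ^ (2 * β - 1) * (1 + e x)) ≤
          (μ {ω | x < Wlim ω}).toReal) ∧
    Tendsto (fun x : ℝ => (μ {ω | x < Wlim ω}).toReal / Fbar (m * x))
      atTop atTop := by
  have hm0 : 0 < m := by linarith
  have hZ := fun n => gw_Z_meas _ ξ Z n (fun j i _ => hmeas j i) hZ0 hZrec
  have hcast : Measurable (fun k : ℕ => (k : ℝ)) := measurable_of_countable _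
  have hWn : ∀ n, Measurable (fun ω => (Z n ω : ℝ) / m ^ n) := fun n =>
    (hcast.comp (hZ n)).div_const _
  simp only [hW] at hWlim
  have hWm : AEMeasurable Wlim μ :=
    aemeasurable_of_tendsto_metrizable_ae atTop (fun n => (hWn n).aemeasurable) hWlim
  have hWpos : ∀ᵐ ω ∂μ, 0 ≤ Wlim ω := by
    filter_upwards [hWlim] with ω hω
    exact ge_of_tendsto' hω fun n => by positivity
  have hsec := gw_second_moment μ (ξ 0 0) (hmeas 0 0) β (by linarith) (by simpa only [hFbar] using htail)
  have hM : ∫⁻ ω, (ξ 0 0 ω : ENNReal) ∂μ = ENNReal.ofReal m := by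
    rw [hm, ofReal_integral_eq_lintegral_ofReal hint (ae_of_all _ fun ω => Nat.cast_nonneg _)]
    simp
  set b := (∫⁻ ω, (ξ 0 0 ω : ENNReal) ^ 2 ∂μ).toReal with hbdef
  have hb0 : 0 ≤ b := ENNReal.toReal_nonneg
  have hB : ∫⁻ ω, (ξ 0 0 ω : ENNReal) ^ 2 ∂μ = ENNReal.ofReal b := (ENNReal.ofReal_toReal hsec).symm
  have hmom := gw_Z_moments μ ξ hmeas hindep hident Z hZ0 hZrec m b hm1 hb0 hM hB
  have hD : 0 < m ^ 2 - m := by nlinarith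
  have hdiv : ∀ (n : ℕ) (ω : Ω), ENNReal.ofReal ((Z n ω : ℝ) / m ^ n) =
      ENNReal.ofReal ((m ^ n)⁻¹) * (Z n ω : ENNReal) := by
    intro n ω
    rw [div_eq_inv_mul, ENNReal.ofReal_mul (by positivity), ENNReal.ofReal_natCast]
  have hdiv2 : ∀ (n : ℕ) (ω : Ω), ENNReal.ofReal (((Z n ω : ℝ) / m ^ n) ^ 2) =
      ENNReal.ofReal ((m ^ (2 * n))⁻¹) * (Z n ω : ENNReal) ^ 2 := by
    intro n ω
    rw [div_pow, ← pow_mul, mul_comm n 2, div_eq_inv_mul, ENNReal.ofReal_mul (by positivity),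
      ENNReal.ofReal_pow (by positivity), ENNReal.ofReal_natCast]
  obtain ⟨hL2, hmean⟩ := gw_limit_moments μ (fun n ω => (Z n ω : ℝ) / m ^ n) hWn
    (fun n ω => by positivity)
    (fun n => by
      simp only [hdiv]
      rw [lintegral_const_mul' _ _ ENNReal.ofReal_ne_top, (hmom n).1,
        ← ENNReal.ofReal_mul (by positivity), inv_mul_cancel₀ (by positivity), ENNReal.ofReal_one])
    (1 + b / (m ^ 2 - m)) (by positivity)
    (fun n => by
      simp only [hdiv2]
      rw [lintegral_const_mul' _ _ ENNReal.ofReal_ne_top]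
      refine (mul_le_mul_right (hmom n).2 _).trans ?_
      rw [← ENNReal.ofReal_mul (by positivity)]
      apply ENNReal.ofReal_le_ofReal
      rw [inv_mul_le_iff₀ (by positivity)]
      have h1 : 0 ≤ b / (m ^ 2 - m) := by positivity
      have h2 : 0 < m ^ n := by positivity
      nlinarith [mul_nonneg h1 h2.le])
    Wlim hWm hWlim
  set ν := μ.map Wlim with hν
  set ρ := μ.map (ξ 0 0) with hρ
  have : IsProbabilityMeasure ν := Measure.isProbabilityMeasure_map hWm
  have : IsProbabilityMeasure ρ := Measure.isProbabilityMeasure_map (hmeas 0 0).aemeasurable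
  have hνpos : ∀ᵐ x ∂ν, 0 ≤ x := by
    rw [hν, ae_map_iff hWm measurableSet_Ici]; exact hWpos
  have hfix := gw_fixed ρ ν m hm0 hνpos (fun t => by
    rw [hν, gw_charFun_eq μ ξ hmeas hindep hident m hm1 Z hZ0 hZrec Wlim hWm hWlim t, hρ,
      integral_map (hmeas 0 0).aemeasurable (measurable_of_countable _).aestronglyMeasurable])
  have hνL2 : MemLp id 2 ν := by
    rw [hν, memLp_map_measure_iff aestronglyMeasurable_id hWm]; exact hL2
  have hνmean : ∫ x, x ∂ν = 1 := by
    rw [hν, integral_map hWm (by fun_prop)]; exact hmean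
  have hνvar : ∫ x, (x - 1) ^ 2 ∂ν = σ2 := by
    rw [hν, integral_map hWm (by fun_prop), hσ2]
  have hTν : ∀ x, μ {ω | x < Wlim ω} = ν (Set.Ioi x) := fun x => by
    rw [hν, Measure.map_apply_of_aemeasurable hWm measurableSet_Ioi]; rfl
  have hF : ∀ᶠ z : ℝ in atTop, Real.exp (-(z ^ β)) / 2 ≤ Fbar z := by
    filter_upwards [htail.eventually (lt_mem_nhds (show (1/2 : ℝ) < 1 by norm_num))] with z hz
    rw [lt_div_iff₀ (Real.exp_pos _)] at hz
    linarith
  have hFρ : ∀ k : ℕ, Fbar k ≤ (ρ (Set.Ici k)).toReal := by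
    intro k
    rw [hFbar, hρ, Measure.map_apply (hmeas 0 0) measurableSet_Ici]
    refine ENNReal.toReal_mono (measure_ne_top _ _) (measure_mono fun ω hω => ?_)
    have : (k : ℝ) < ξ 0 0 ω := hω
    exact (Nat.cast_lt.1 this).le
  have hρpos : ∀ k : ℕ, 0 < ρ (Set.Ici k) := by
    intro k
    obtain ⟨j, hj, hkj⟩ := ((tendsto_natCast_atTop_atTop.eventually hF).and (eventually_ge_atTop k)).exists
    have h1 : 0 < (ρ (Set.Ici j)).toReal :=
      lt_of_lt_of_le (by positivity) (hj.trans (hFρ j))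
    exact lt_of_lt_of_le (ENNReal.toReal_pos_iff.1 h1).1 (measure_mono (Set.Ici_subset_Ici.2 hkj))
  have hσ : 0 < σ2 := by
    rw [← hνvar]; exact gw_sigma_pos ρ ν m hρpos hνL2 hfix
  have hkey := gw_key_y β σ2 hβ hβ1 hσ (fun y => (ν (Set.Ioi (y / m))).toReal) Fbar
    (fun A n => (gwS ν n (Set.Ioi (n + A * √n))).toReal) hF
    (fun y A p n hp hy => by
      have h1 := hfix (p * n) (y / m)
      have h2 := gwS_block ν n p hp (n + A * √n)
      rw [mul_div_cancel₀ _ hm0.ne'] at h1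
      have h3 : gwS ν (p * n) (Set.Ioi (p * (n + A * √n))) ≤ gwS ν (p * n) (Set.Ioi y) :=
        measure_mono (Set.Ioi_subset_Ioi (by linarith))
      have h4 : ρ (Set.Ici (p * n)) * (gwS ν n (Set.Ioi (n + A * √n))) ^ p ≤ ν (Set.Ioi (y / m)) :=
        (mul_le_mul_right (h2.trans h3) _).trans h1
      have h5 := ENNReal.toReal_mono (measure_ne_top _ _) h4
      rw [ENNReal.toReal_mul, ENNReal.toReal_pow] at h5
      refine le_trans ?_ h5
      have h6 := hFρ (p * n)
      push_cast at h6
      gcongr)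
    (fun δ hδ => gwS_clt ν hνL2 hνmean σ2 hσ hνvar δ hδ)
  refine gw_final β σ2 m hβ hm0 hσ (fun x => (μ {ω | x < Wlim ω}).toReal) Fbar htail (fun ε hε => ?_)
  have hmx : Tendsto (fun x : ℝ => m * x) atTop atTop := tendsto_id.const_mul_atTop hm0
  filter_upwards [hmx.eventually (hkey ε hε)] with x hx
  rw [mul_div_cancel_left₀ _ hm0.ne'] at hx
  simpa only [hTν] using hx
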